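/- Let N ≥ 1 and let a : ℤ → ℂ. The (N+1)×(N+1) Toeplitz matrix T with entries T j k = a (j - k) is normal (T * Tᴴ = Tᴴ * T) if and only if for all m, n with 1 ≤ m, n ≤ N: a m * conj(a n) - conj(a (-m)) * a (-n) + conj(a (N+1-m)) * a (N+1-n) - a (-(N+1-m)) * conj(a (-(N+1-n))) = 0. -/

import Mathlib

open Matrix

/-- The defect `a m * conj (a n) - conj (a (-m)) * a (-n)`, whose sums along a diagonal are the
entries of the self-commutator of a Toeplitz matrix. -/
noncomputable def toeplitzDefect (a : ℤ → ℂ) (m n : ℤ) : ℂ :=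
  a m * (starRingEnd ℂ) (a n) - (starRingEnd ℂ) (a (-m)) * a (-n)

theorem toeplitzDefect_neg_neg (a : ℤ → ℂ) (m n : ℤ) :
    toeplitzDefect a (-m) (-n) = -toeplitzDefect a n m := by
  simp only [toeplitzDefect, neg_neg]
  ring

theorem conj_toeplitzDefect (a : ℤ → ℂ) (m n : ℤ) :
    (starRingEnd ℂ) (toeplitzDefect a m n) = toeplitzDefect a n m := by
  simp only [toeplitzDefect, map_sub, map_mul, Complex.conj_conj]
  ring

/-- The `(j, k)` entry of `T * Tᴴ - Tᴴ * T` for the Toeplitz matrix `T` of order `N + 1`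
generated by `a`. -/
noncomputable def toeplitzCommutator (a : ℤ → ℂ) (N : ℕ) (j k : ℤ) : ℂ :=
  ∑ l ∈ Finset.range (N + 1), toeplitzDefect a (j - l) (k - l)

theorem conj_toeplitzCommutator (a : ℤ → ℂ) (N : ℕ) (j k : ℤ) :
    (starRingEnd ℂ) (toeplitzCommutator a N j k) = toeplitzCommutator a N k j := by
  simp only [toeplitzCommutator, map_sum, conj_toeplitzDefect]

theorem toeplitzCommutator_add_one (a : ℤ → ℂ) (N : ℕ) (j k : ℤ) :
    toeplitzCommutator a N (j + 1) (k + 1) = toeplitzCommutator a N j k +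
      (toeplitzDefect a (j + 1) (k + 1) - toeplitzDefect a (j - N) (k - N)) := by
  rw [toeplitzCommutator, toeplitzCommutator, Finset.sum_range_succ', Finset.sum_range_succ]
  simp only [Nat.cast_add, Nat.cast_one, add_sub_add_right_eq_sub, Nat.cast_zero, sub_zero]
  ring

theorem sum_range_eq_zero_of_reflect {f : ℕ → ℂ} {n : ℕ}
    (h : ∀ i < n, f (n - 1 - i) = -f i) : ∑ i ∈ Finset.range n, f i = 0 := by
  have h1 := Finset.sum_range_reflect f n
  rw [Finset.sum_congr rfl fun i hi => h i (Finset.mem_range.1 hi), Finset.sum_neg_distrib] at h1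
  exact self_eq_neg.1 h1.symm

theorem toeplitzCommutator_zero_right {a : ℤ → ℂ} {N : ℕ}
    (h : ∀ m n : ℤ, 1 ≤ m → m ≤ N → 1 ≤ n → n ≤ N →
      toeplitzDefect a m n = toeplitzDefect a (m - (N + 1)) (n - (N + 1)))
    {k : ℕ} (hk : k ≤ N) : toeplitzCommutator a N k 0 = 0 := by
  obtain ⟨p, rfl⟩ := Nat.exists_eq_add_of_le hk
  rw [toeplitzCommutator, show k + p + 1 = (k + 1) + p by ring, Finset.sum_range_add,
    sum_range_eq_zero_of_reflect, sum_range_eq_zero_of_reflect, add_zero]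
  · intro i hi
    rw [← toeplitzDefect_neg_neg, eq_comm, h _ _ (by lia) (by lia) (by lia) (by lia)]
    congr 1 <;> lia
  · intro i hi
    rw [← toeplitzDefect_neg_neg]
    congr 1 <;> lia

theorem toeplitzCommutator_eq_zero {a : ℤ → ℂ} {N : ℕ}
    (h : ∀ m n : ℤ, 1 ≤ m → m ≤ N → 1 ≤ n → n ≤ N →
      toeplitzDefect a m n = toeplitzDefect a (m - (N + 1)) (n - (N + 1)))
    {j k : ℕ} (hj : j ≤ N) (hk : k ≤ N) : toeplitzCommutator a N j k = 0 := by
  induction j generalizing k with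
  | zero =>
    rw [← conj_toeplitzCommutator, Nat.cast_zero, toeplitzCommutator_zero_right h hk, map_zero]
  | succ j ih =>
    cases k with
    | zero => exact_mod_cast toeplitzCommutator_zero_right h hj
    | succ k =>
      have h1 := h (j + 1) (k + 1) (by lia) (by lia) (by lia) (by lia)
      simp only [add_sub_add_right_eq_sub] at h1
      push_cast
      rw [toeplitzCommutator_add_one, ih (by lia) (by lia), h1, sub_self, add_zero]

theorem mul_conjTranspose_sub_conjTranspose_mul_apply {N : ℕ} {a : ℤ → ℂ}
    {T : Matrix (Fin (N + 1)) (Fin (N + 1)) ℂ}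
    (hT : ∀ j k : Fin (N + 1), T j k = a ((j : ℤ) - (k : ℤ))) (j k : Fin (N + 1)) :
    (T * Tᴴ) j k - (Tᴴ * T) j k = toeplitzCommutator a N j k := by
  rw [toeplitzCommutator, Finset.sum_range, mul_apply, mul_apply, ← Finset.sum_sub_distrib]
  simp only [conjTranspose_apply, hT, toeplitzDefect, neg_sub, starRingEnd_apply]

theorem normal_toeplitz_iff_condition (N : ℕ) (hN : 1 ≤ N) (a : ℤ → ℂ)
    (T : Matrix (Fin (N + 1)) (Fin (N + 1)) ℂ)
    (hT : ∀ j k : Fin (N + 1), T j k = a ((j : ℤ) - (k : ℤ))) :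
    T * Tᴴ = Tᴴ * T ↔
      ∀ m n : ℤ, 1 ≤ m → m ≤ N → 1 ≤ n → n ≤ N →
        a m * (starRingEnd ℂ) (a n) - (starRingEnd ℂ) (a (-m)) * a (-n)
          + (starRingEnd ℂ) (a ((N : ℤ) + 1 - m)) * a ((N : ℤ) + 1 - n)
          - a (-((N : ℤ) + 1 - m)) * (starRingEnd ℂ) (a (-((N : ℤ) + 1 - n))) = 0 := by
  have key (m n : ℤ) : a m * (starRingEnd ℂ) (a n) - (starRingEnd ℂ) (a (-m)) * a (-n)
          + (starRingEnd ℂ) (a ((N : ℤ) + 1 - m)) * a ((N : ℤ) + 1 - n)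
          - a (-((N : ℤ) + 1 - m)) * (starRingEnd ℂ) (a (-((N : ℤ) + 1 - n))) =
        toeplitzDefect a m n - toeplitzDefect a (m - (N + 1)) (n - (N + 1)) := by
    simp only [toeplitzDefect, neg_sub]
    ring
  simp only [key, sub_eq_zero]
  constructor
  · intro h m n hm hmN hn hnN
    have hzero (j k : ℕ) (hj : j < N + 1) (hk : k < N + 1) : toeplitzCommutator a N j k = 0 := by
      rw [← mul_conjTranspose_sub_conjTranspose_mul_apply hT ⟨j, hj⟩ ⟨k, hk⟩, h, sub_self]
    obtain ⟨j, rfl⟩ : ∃ j : ℕ, m = j + 1 := ⟨(m - 1).toNat, by lia⟩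
    obtain ⟨k, rfl⟩ : ∃ k : ℕ, n = k + 1 := ⟨(n - 1).toNat, by lia⟩
    have h1 := toeplitzCommutator_add_one a N j k
    have h2 := hzero (j + 1) (k + 1) (by lia) (by lia)
    push_cast at h2
    rw [h2, hzero j k (by lia) (by lia), zero_add, eq_comm, sub_eq_zero] at h1
    rwa [add_sub_add_right_eq_sub, add_sub_add_right_eq_sub]
  · intro h
    ext j k
    rw [← sub_eq_zero, mul_conjTranspose_sub_conjTranspose_mul_apply hT]
    exact toeplitzCommutator_eq_zero h (Nat.lt_succ_iff.1 j.2) (Nat.lt_succ_iff.1 k.2)
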